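/- arXiv:1509.05647 — 2 statements merged into one kernel-verified Lean document; each statement's English description precedes it below -/
import Mathlib

section
/- (Inverse Conditioning.) Let X be a d×d real symmetric positive semidefinite matrix with eigenvalues λ1 ≥ λ2 ≥ ... ≥ λd, and let δ = λ1 − λ2 > 0. Fix a scalar a > 0 and let λ satisfy λ1 < λ ≤ λ1 + aδ. Then the matrix M⁻¹ = (λI − X)⁻¹ is positive definite, its largest and second largest eigenvalues are 1/(λ−λ1) and 1/(λ−λ2) respectively, and the ratio of its largest eigenvalue to its eigengap satisfies λ1(M⁻¹)/(λ1(M⁻¹) − λ2(M⁻¹)) ≤ 1 + a. -/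
open Matrix

/-- A real matrix with an orthonormal family of eigenvectors is orthogonally diagonalized by it. -/
theorem eq_transpose_mul_diagonal_mul {n : Type*} [Fintype n] [DecidableEq n]
    {A u : Matrix n n ℝ} {μ : n → ℝ} (hu : u * uᵀ = 1)
    (h : ∀ i, A.mulVec (u i) = μ i • u i) : A = uᵀ * diagonal μ * u := by
  have hA : A * uᵀ = uᵀ * diagonal μ := by
    ext k i
    rw [mul_diagonal, transpose_apply, mul_comm]
    exact congrFun (h i) k
  rw [← hA, Matrix.mul_assoc, mul_eq_one_comm.mp hu, Matrix.mul_one]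

/-- A real matrix with an orthonormal family of eigenvectors with positive eigenvalues is
positive definite. -/
theorem posDef_of_orthonormal_eigenvectors {n : Type*} [Fintype n] [DecidableEq n]
    {A u : Matrix n n ℝ} {μ : n → ℝ} (hu : u * uᵀ = 1)
    (h : ∀ i, A.mulVec (u i) = μ i • u i) (hμ : ∀ i, 0 < μ i) : A.PosDef := by
  rw [eq_transpose_mul_diagonal_mul hu h, ← conjTranspose_eq_transpose_of_trivial u]
  exact (PosDef.diagonal hμ).conjTranspose_mul_mul_same
    (mulVec_injective_of_isUnit (IsUnit.of_mul_eq_one uᵀ hu))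

/-- An eigenvector of an invertible matrix is an eigenvector of the inverse, with inverse
eigenvalue. -/
theorem inv_mulVec_eq_inv_smul {n K : Type*} [Fintype n] [DecidableEq n] [Field K]
    {A : Matrix n n K} (hA : IsUnit A.det) {c : K} (hc : c ≠ 0) {v : n → K}
    (h : A.mulVec v = c • v) : A⁻¹.mulVec v = c⁻¹ • v := by
  have hv : v = c • A⁻¹.mulVec v := by
    rw [← mulVec_smul, ← h, mulVec_mulVec, nonsing_inv_mul _ hA, one_mulVec]
  exact (eq_inv_smul_iff₀ hc).mpr hv.symm

/-- inverse conditioning: let `X` be symmetric positive semidefinite with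
descending eigenvalues `lam` (orthonormal eigenvectors `u`) and eigengap
`δ = lam 0 - lam 1 > 0`. If `a > 0` and `lam 0 < l ≤ lam 0 + a·δ`, then `(l•I − X)⁻¹` is
positive definite, its eigenvalues are `(l − lam i)⁻¹` with `(l - lam 0)⁻¹` the largest and
`(l - lam 1)⁻¹` the second largest, and the ratio of its largest eigenvalue to its eigengap
is at most `1 + a`. -/
theorem inverse_conditioning
    (d : ℕ) (X : Matrix (Fin (d+2)) (Fin (d+2)) ℝ)
    (lam : Fin (d+2) → ℝ) (u : Fin (d+2) → Fin (d+2) → ℝ)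
    (hX : X.IsSymm) (hpsd : X.PosSemidef)
    (hdesc : ∀ i j : Fin (d+2), i ≤ j → lam j ≤ lam i)
    (hON : ∀ i j, u i ⬝ᵥ u j = if i = j then (1 : ℝ) else 0)
    (heig : ∀ i, X.mulVec (u i) = lam i • u i)
    (a l : ℝ) (ha : 0 < a)
    (hgap : 0 < lam 0 - lam 1)
    (hl1 : lam 0 < l) (hl2 : l ≤ lam 0 + a * (lam 0 - lam 1)) :
    ((l • (1 : Matrix (Fin (d+2)) (Fin (d+2)) ℝ) - X)⁻¹).PosDef ∧
    (∀ i, ((l • (1 : Matrix (Fin (d+2)) (Fin (d+2)) ℝ) - X)⁻¹).mulVec (u i)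
        = (l - lam i)⁻¹ • u i) ∧
    (∀ i, (l - lam i)⁻¹ ≤ (l - lam 0)⁻¹) ∧
    (∀ i, i ≠ 0 → (l - lam i)⁻¹ ≤ (l - lam 1)⁻¹) ∧
    (l - lam 0)⁻¹ / ((l - lam 0)⁻¹ - (l - lam 1)⁻¹) ≤ 1 + a := by
  have hpos : ∀ i, 0 < l - lam i := fun i => by
    linarith [hdesc 0 i (Fin.zero_le i)]
  have hM : ∀ i, (l • (1 : Matrix (Fin (d+2)) (Fin (d+2)) ℝ) - X).mulVec (u i)
      = (l - lam i) • u i := fun i => by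
    rw [sub_mulVec, smul_mulVec, one_mulVec, heig, sub_smul]
  have hu : of u * (of u)ᵀ = 1 := by
    ext i j
    rw [one_apply, ← hON i j]
    rfl
  have hpd := posDef_of_orthonormal_eigenvectors hu hM hpos
  refine ⟨hpd.inv, fun i => inv_mulVec_eq_inv_smul hpd.det_pos.ne'.isUnit (hpos i).ne' (hM i),
    fun i => ?_, fun i hi => ?_, ?_⟩
  · exact inv_anti₀ (hpos 0) (by linarith [hdesc 0 i (Fin.zero_le i)])
  · exact inv_anti₀ (hpos 1) (by linarith [hdesc 1 i (Fin.one_le_of_ne_zero hi)])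
  · have h0 := hpos 0
    have h1 := hpos 1
    have hratio : (l - lam 0)⁻¹ / ((l - lam 0)⁻¹ - (l - lam 1)⁻¹)
        = (l - lam 1) / (lam 0 - lam 1) := by
      rw [inv_sub_inv h0.ne' h1.ne', sub_sub_sub_cancel_left]
      field_simp
    rw [hratio, div_le_iff₀ hgap]
    linarith
end

section
/- (SVRG variance bound.) Let f_1,...,f_n : ℝ^d → ℝ be differentiable functions, each β-smooth (i.e., ‖∇f_i(x) − ∇f_i(y)‖ ≤ β‖x−y‖ for all x,y), and let F(x) = (1/n)Σ_{i=1}^n f_i(x). Let x* ∈ ℝ^d satisfy ∇F(x*) = 0. Then for every x, x̃ ∈ ℝ^d, the averaged squared norm of the variance-reduced gradient estimator satisfies (1/n)Σ_{i=1}^n ‖∇f_i(x) − ∇f_i(x̃) + ∇F(x̃)‖² ≤ 2β²(‖x − x*‖² + ‖x̃ − x*‖²). -/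
open scoped InnerProductSpace

/-- The sum of squared deviations from the mean is at most the sum of squares. -/
theorem sum_norm_sub_mean_sq_le {ι E : Type*} [Fintype ι] [NormedAddCommGroup E]
    [InnerProductSpace ℝ E] (b : ι → E) (m : E) (hm : ∑ i, b i = (Fintype.card ι : ℝ) • m) :
    ∑ i, ‖b i - m‖ ^ 2 ≤ ∑ i, ‖b i‖ ^ 2 := by
  have h : ∑ i, ‖b i - m‖ ^ 2 = ∑ i, ‖b i‖ ^ 2 - Fintype.card ι * ‖m‖ ^ 2 := by
    simp only [norm_sub_sq_real, Finset.sum_add_distrib, Finset.sum_sub_distrib,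
      ← Finset.mul_sum, ← sum_inner, hm, real_inner_smul_left, real_inner_self_eq_norm_sq,
      Finset.sum_const, Finset.card_univ, nsmul_eq_mul]
    ring
  rw [h]
  exact sub_le_self _ (by positivity)

theorem norm_sub_sq_le_two_mul {E : Type*} [SeminormedAddCommGroup E] (a b : E) :
    ‖a - b‖ ^ 2 ≤ 2 * (‖a‖ ^ 2 + ‖b‖ ^ 2) :=
  (pow_le_pow_left₀ (norm_nonneg _) (norm_sub_le a b) 2).trans add_sq_le

theorem gradient_const_mul_sum {ι E : Type*} [Fintype ι] [NormedAddCommGroup E]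
    [InnerProductSpace ℝ E] [CompleteSpace E] {f : ι → E → ℝ} (c : ℝ) {x : E}
    (hf : ∀ i, DifferentiableAt ℝ (f i) x) :
    gradient (fun y => c * ∑ i, f i y) x = c • ∑ i, gradient (f i) x := by
  have h := (HasFDerivAt.fun_sum (u := Finset.univ)
    fun i _ => (hf i).hasFDerivAt).const_mul c
  simp only [gradient, h.fderiv, map_smulₛₗ, map_sum, conj_trivial]

/-- SVRG variance bound: let `f 1, ..., f n : ℝ^d → ℝ` be differentiable and
`β`-smooth, let `F = (1/n)·Σᵢ f i`, and let `x*` satisfy `∇F(x*) = 0`. Then for all `x, x̃`,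
`(1/n)·Σᵢ ‖∇fᵢ(x) − ∇fᵢ(x̃) + ∇F(x̃)‖² ≤ 2β²(‖x − x*‖² + ‖x̃ − x*‖²)`. -/
theorem svrg_variance_bound
    (d n : ℕ) (f : Fin n → EuclideanSpace ℝ (Fin d) → ℝ) (β : ℝ)
    (hdiff : ∀ i, Differentiable ℝ (f i))
    (hsmooth : ∀ i (x y : EuclideanSpace ℝ (Fin d)),
        ‖gradient (f i) x - gradient (f i) y‖ ≤ β * ‖x - y‖)
    (F : EuclideanSpace ℝ (Fin d) → ℝ)
    (hF : ∀ x, F x = (1 / (n : ℝ)) * ∑ i, f i x)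
    (xstar : EuclideanSpace ℝ (Fin d)) (hstar : gradient F xstar = 0)
    (x xt : EuclideanSpace ℝ (Fin d)) :
    (1 / (n : ℝ)) * ∑ i, ‖gradient (f i) x - gradient (f i) xt + gradient F xt‖ ^ 2
      ≤ 2 * β ^ 2 * (‖x - xstar‖ ^ 2 + ‖xt - xstar‖ ^ 2) := by
  rcases Nat.eq_zero_or_pos n with rfl | hn
  · simp only [Finset.univ_eq_empty, Finset.sum_empty, mul_zero]
    positivity
  have hn0 : (0 : ℝ) < n := Nat.cast_pos.mpr hn
  have hgrad (y) : ∑ i, gradient (f i) y = (n : ℝ) • gradient F y := by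
    rw [funext hF, gradient_const_mul_sum _ fun i => hdiff i y, smul_smul,
      mul_one_div_cancel hn0.ne', one_smul]
  have hmean : ∑ i, (gradient (f i) xt - gradient (f i) xstar)
      = (Fintype.card (Fin n) : ℝ) • gradient F xt := by
    rw [Finset.sum_sub_distrib, hgrad, hgrad, hstar, smul_zero, sub_zero, Fintype.card_fin]
  have hsum (y) : ∑ i, ‖gradient (f i) y - gradient (f i) xstar‖ ^ 2
      ≤ n * (β ^ 2 * ‖y - xstar‖ ^ 2) := by
    calc _ ≤ ∑ _i : Fin n, (β * ‖y - xstar‖) ^ 2 :=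
          Finset.sum_le_sum fun i _ =>
            pow_le_pow_left₀ (norm_nonneg _) (hsmooth i y xstar) 2
      _ = _ := by simp [mul_pow]
  rw [one_div, inv_mul_le_iff₀ hn0]
  calc _ ≤ ∑ i, 2 * (‖gradient (f i) x - gradient (f i) xstar‖ ^ 2
        + ‖gradient (f i) xt - gradient (f i) xstar - gradient F xt‖ ^ 2) := by
        refine Finset.sum_le_sum fun i _ => ?_
        rw [show gradient (f i) x - gradient (f i) xt + gradient F xt
          = gradient (f i) x - gradient (f i) xstar
            - (gradient (f i) xt - gradient (f i) xstar - gradient F xt) by abel]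
        exact norm_sub_sq_le_two_mul _ _
    _ ≤ _ := by
        rw [← Finset.mul_sum, Finset.sum_add_distrib]
        linarith [hsum x, hsum xt, sum_norm_sub_mean_sq_le _ _ hmean]
end
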